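/- For each fixed integer k ≥ 1, the function m ↦ c(m,k) is non-decreasing in m, and there exist constants c₁(k), c₂(k) > 0 such that c₁(k)·(m^{2^{2k−1}−2k−1} + 1) ≤ c(m,k) ≤ c₂(k)·(m^{2^{2k−1}−2k−1} + 1) for all integers m ≥ 1. -/

import Mathlib

open scoped Classical

/-- `permTupleCount m k` is the number of tuples `(r_I)` indexed by the subsets `I` of
`{1,…,2k}` (normalized by `r ∅ = 0`, so that effectively only nonempty `I` matter) of
non-negative integers such that `r_I ∈ {0,1}` whenever `#I` is odd, and
`∑_{I ∋ i} r_I = m` for each `i ∈ {1,…,2k}`. -/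
noncomputable def permTupleCount (m k : ℕ) : ℕ :=
  Nat.card {r : Finset (Fin (2 * k)) → ℕ //
    r ∅ = 0 ∧
    (∀ I : Finset (Fin (2 * k)), Odd I.card → r I ≤ 1) ∧
    (∀ i : Fin (2 * k),
      ∑ I ∈ Finset.univ.filter (fun I : Finset (Fin (2 * k)) => i ∈ I), r I = m)}

/-- A tuple `r` indexed by the subsets of an `n`-element set is balanced of weight `m` if it is
counted by `permTupleCount` (for `n = 2 * k`). -/
def IsBalanced {n : ℕ} (m : ℕ) (r : Finset (Fin n) → ℕ) : Prop :=
  r ∅ = 0 ∧ (∀ I : Finset (Fin n), Odd I.card → r I ≤ 1) ∧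
    ∀ i : Fin n, ∑ I ∈ Finset.univ.filter (fun I : Finset (Fin n) => i ∈ I), r I = m

theorem IsBalanced.le {n m : ℕ} {r : Finset (Fin n) → ℕ} (h : IsBalanced m r)
    (I : Finset (Fin n)) : r I ≤ m := by
  rcases I.eq_empty_or_nonempty with rfl | ⟨i, hi⟩
  · simp [h.1]
  · rw [← h.2.2 i]
    exact Finset.single_le_sum (f := r) (fun _ _ => Nat.zero_le _) (by simpa using hi)

/-- The finite set of balanced tuples of weight `m`. -/
noncomputable def balancedTuples (n m : ℕ) : Finset (Finset (Fin n) → ℕ) :=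
  (Fintype.piFinset fun _ => Finset.range (m + 1)).filter (IsBalanced m)

theorem mem_balancedTuples {n m : ℕ} {r : Finset (Fin n) → ℕ} :
    r ∈ balancedTuples n m ↔ IsBalanced m r := by
  simp only [balancedTuples, Finset.mem_filter, Fintype.mem_piFinset, Finset.mem_range,
    Nat.lt_succ_iff, and_iff_right_iff_imp]
  exact fun h I => h.le I

theorem permTupleCount_eq_card (m k : ℕ) :
    permTupleCount m k = (balancedTuples (2 * k) m).card :=
  Nat.subtype_card _ fun _ => mem_balancedTuples

theorem IsBalanced.add_univ {n m : ℕ} (hn : n ≠ 0) (hev : Even n) {r : Finset (Fin n) → ℕ}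
    (h : IsBalanced m r) (d : ℕ) :
    IsBalanced (m + d) (fun I => r I + if I = Finset.univ then d else 0) := by
  have : NeZero n := ⟨hn⟩
  refine ⟨?_, fun I hI => ?_, fun i => ?_⟩
  · have : (∅ : Finset (Fin n)) ≠ Finset.univ := Finset.univ_nonempty.ne_empty.symm
    simp [h.1, this]
  · have : I ≠ Finset.univ := by
      rintro rfl
      rw [Finset.card_fin] at hI
      exact Nat.not_odd_iff_even.2 hev hI
    simpa [this] using h.2.1 I hI
  · rw [Finset.sum_add_distrib, h.2.2 i, Finset.sum_ite_eq']
    simp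

theorem card_balancedTuples_mono {n : ℕ} (hn : n ≠ 0) (hev : Even n) :
    Monotone fun m => (balancedTuples n m).card := by
  intro m₁ m₂ h
  obtain ⟨d, rfl⟩ := Nat.exists_eq_add_of_le h
  refine Finset.card_le_card_of_injOn
    (fun r I => r I + if I = Finset.univ then d else 0) ?_ ?_
  · intro r hr
    exact mem_balancedTuples.2 ((mem_balancedTuples.1 hr).add_univ hn hev d)
  · intro r _ r' _ h
    funext I
    exact Nat.add_right_cancel (congrFun h I)

theorem one_le_card_balancedTuples {n : ℕ} (hn : n ≠ 0) (hev : Even n) (m : ℕ) :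
    1 ≤ (balancedTuples n m).card := by
  refine le_trans ?_ (card_balancedTuples_mono hn hev (Nat.zero_le m))
  exact Finset.card_pos.2 ⟨0, mem_balancedTuples.2 (by simp [IsBalanced])⟩

/-- The nonempty subsets of even cardinality. -/
def evenSets (n : ℕ) : Finset (Finset (Fin n)) :=
  Finset.univ.filter fun I => I ≠ ∅ ∧ Even I.card

theorem mem_evenSets {n : ℕ} {I : Finset (Fin n)} :
    I ∈ evenSets n ↔ I ≠ ∅ ∧ Even I.card := by
  simp [evenSets]

theorem card_evenSets {n : ℕ} (hn : n ≠ 0) : (evenSets n).card + 1 = 2 ^ (n - 1) := by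
  have : NeZero n := ⟨hn⟩
  have heven : insert ∅ (evenSets n) = Finset.univ.filter fun I => Even I.card := by
    ext I
    by_cases hI : I = ∅ <;> simp [mem_evenSets, hI]
  have hcard : (evenSets n).card + 1 =
      (Finset.univ.filter fun I : Finset (Fin n) => Even I.card).card := by
    rw [← heven, Finset.card_insert_of_notMem (by simp [mem_evenSets])]
  have htotal := Finset.card_filter_add_card_filter_not (s := Finset.univ)
    (fun I : Finset (Fin n) => Even I.card)
  have halt := Finset.sum_powerset_neg_one_pow_card_of_nonempty
    (Finset.univ_nonempty (α := Fin n))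
  rw [Finset.powerset_univ, ← Finset.sum_filter_add_sum_filter_not _
    (fun I : Finset (Fin n) => Even I.card),
    Finset.sum_congr rfl (g := fun _ => (1 : ℤ))
      (fun I hI => (Finset.mem_filter.1 hI).2.neg_one_pow),
    Finset.sum_congr rfl (g := fun _ => (-1 : ℤ))
      (fun I hI => (Nat.not_even_iff_odd.1 (Finset.mem_filter.1 hI).2).neg_one_pow)] at halt
  simp only [Finset.sum_const, nsmul_eq_mul, mul_one, mul_neg] at halt
  rw [Finset.card_univ, Fintype.card_finset, Fintype.card_fin] at htotal
  have hpow : 2 ^ n = 2 * 2 ^ (n - 1) := by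
    rw [← pow_succ', Nat.sub_add_cancel (Nat.pos_of_ne_zero hn)]
  omega

/-- `B` determines balanced tuples if two balanced tuples that agree off `B` are equal. -/
def IsDetermining {n : ℕ} (B : Finset (Finset (Fin n))) : Prop :=
  ∀ (m : ℕ) (r r' : Finset (Fin n) → ℕ), IsBalanced m r → IsBalanced m r' →
    (∀ I ∉ B, r I = r' I) → r = r'

theorem card_balancedTuples_le {n : ℕ} {B : Finset (Finset (Fin n))} (hB : B ⊆ evenSets n)
    (hdet : IsDetermining B) (m : ℕ) :
    (balancedTuples n m).card ≤ 2 ^ 2 ^ n * (m + 1) ^ ((evenSets n).card - B.card) := by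
  let g : Finset (Fin n) → Finset ℕ := fun I =>
    if I ∈ evenSets n \ B then Finset.range (m + 1) else Finset.range 2
  calc (balancedTuples n m).card ≤ (Fintype.piFinset g).card := by
        refine Finset.card_le_card_of_injOn (fun r I => if I ∈ B then 0 else r I) ?_ ?_
        · intro r hr
          have hr := mem_balancedTuples.1 hr
          simp only [Finset.mem_coe, Fintype.mem_piFinset]
          intro I
          by_cases hIB : I ∈ B
          · simp [g, hIB]
          by_cases hIE : I ∈ evenSets n
          · simpa [g, hIB, hIE, Nat.lt_succ_iff] using hr.le I
          · simp only [g, hIB, hIE, if_false, Finset.mem_sdiff, false_and, Finset.mem_range]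
            by_cases hI : I = ∅
            · simp [hI, hr.1]
            · have : Odd I.card := by
                rw [mem_evenSets] at hIE
                exact Nat.not_even_iff_odd.1 fun h => hIE ⟨hI, h⟩
              exact Nat.lt_succ_iff.2 (hr.2.1 I this)
        · intro r hr r' hr' h
          refine hdet m r r' (mem_balancedTuples.1 hr) (mem_balancedTuples.1 hr') fun I hI => ?_
          simpa [hI] using congrFun h I
    _ = ∏ I, (g I).card := Fintype.card_piFinset g
    _ ≤ ∏ I, 2 * (if I ∈ evenSets n \ B then m + 1 else 1) := by
        refine Finset.prod_le_prod' fun I _ => ?_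
        simp only [g]
        split_ifs
        · rw [Finset.card_range]; omega
        · simp
    _ = 2 ^ 2 ^ n * (m + 1) ^ ((evenSets n).card - B.card) := by
        rw [Finset.prod_mul_distrib, Finset.prod_const, Fintype.prod_ite_mem, Finset.prod_const,
          Finset.card_sdiff_of_subset hB, Finset.card_univ, Fintype.card_finset, Fintype.card_fin]

theorem isDetermining_singleton_univ {n : ℕ} (hn : n ≠ 0) :
    IsDetermining ({Finset.univ} : Finset (Finset (Fin n))) := by
  have : NeZero n := ⟨hn⟩
  intro m r r' hr hr' h
  have hoff : ∀ I, I ≠ Finset.univ → r I = r' I := fun I hI => h I (by simpa using hI)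
  have hsum := (hr.2.2 0).trans (hr'.2.2 0).symm
  have hmem : (Finset.univ : Finset (Fin n)) ∈
      Finset.univ.filter (fun I : Finset (Fin n) => 0 ∈ I) := by simp
  rw [← Finset.add_sum_erase _ _ hmem, ← Finset.add_sum_erase _ _ hmem,
    Finset.sum_congr rfl fun I hI => hoff I (Finset.ne_of_mem_erase hI)] at hsum
  funext I
  by_cases hI : I = Finset.univ
  · exact hI ▸ Nat.add_right_cancel hsum
  · exact hoff I hI

theorem exists_isDetermining {n : ℕ} (hn : 3 ≤ n) :
    ∃ B ⊆ evenSets n, B.card = n ∧ IsDetermining B := by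
  obtain ⟨n, rfl⟩ := Nat.exists_eq_add_of_le' hn
  let b : Fin (n + 2) → Finset (Fin (n + 3)) := fun t => {0, t.succ}
  have hbmem : ∀ t s : Fin (n + 2), s.succ ∈ b t ↔ s = t := fun t s => by
    simp [b, Fin.succ_ne_zero]
  have hbinj : Function.Injective b := fun t s h => by
    rw [← hbmem s t, ← h, hbmem]
  have hmod : 2 % (n + 3) = 2 := Nat.mod_eq_of_lt (by omega)
  have h12 : (1 : Fin (n + 3)) ≠ 2 := by simp [Fin.ext_iff, hmod]
  have h01 : (0 : Fin (n + 3)) ∉ ({1, 2} : Finset (Fin (n + 3))) := by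
    simp [Fin.ext_iff, hmod]
  have hnot : ({1, 2} : Finset (Fin (n + 3))) ∉ Finset.univ.image b := by
    intro h
    obtain ⟨t, -, ht⟩ := Finset.mem_image.1 h
    exact h01 (ht ▸ by simp [b])
  refine ⟨insert {1, 2} (Finset.univ.image b), ?_, ?_, ?_⟩
  · intro I hI
    rw [mem_evenSets]
    rcases Finset.mem_insert.1 hI with rfl | hI
    · exact ⟨by simp, by rw [Finset.card_pair h12]; exact even_two⟩
    · obtain ⟨t, -, rfl⟩ := Finset.mem_image.1 hI
      exact ⟨by simp [b], by rw [Finset.card_pair (Fin.succ_ne_zero t).symm]; exact even_two⟩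
  · rw [Finset.card_insert_of_notMem hnot, Finset.card_image_of_injective _ hbinj]
    simp
  · intro m r r' hr hr' h
    let d : Finset (Fin (n + 3)) → ℤ := fun I => (r I : ℤ) - r' I
    have hsum : ∀ i : Fin (n + 3), (if i ∈ ({1, 2} : Finset (Fin (n + 3))) then d {1, 2} else 0) +
        ∑ t, (if i ∈ b t then d (b t) else 0) = 0 := by
      intro i
      rw [← Finset.sum_image (s := Finset.univ) (g := b)
        (f := fun I => if i ∈ I then d I else 0) hbinj.injOn,
        ← Finset.sum_insert (f := fun I => if i ∈ I then d I else 0) hnot,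
        Finset.sum_subset (Finset.subset_univ _)
          (fun I _ hI => by simp [d, h I hI]), ← Finset.sum_filter]
      simp only [d]
      rw [Finset.sum_sub_distrib, ← Nat.cast_sum, ← Nat.cast_sum, hr.2.2, hr'.2.2, sub_self]
    have hsucc : ∀ s : Fin (n + 2),
        d (b s) = -if s.succ ∈ ({1, 2} : Finset (Fin (n + 3))) then d {1, 2} else 0 := by
      intro s
      have := hsum s.succ
      simp only [hbmem, Finset.sum_ite_eq, Finset.mem_univ, if_true] at this
      linarith
    have hpair : d {1, 2} = 0 := by
      have := hsum 0
      have h0 : ∀ t, (0 : Fin (n + 3)) ∈ b t := fun t => by simp [b]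
      simp only [h01, if_false, h0, if_true, hsucc] at this
      rw [Fin.sum_univ_succ, Fin.sum_univ_succ] at this
      simp [Fin.ext_iff, hmod] at this
      omega
    have hd : ∀ I, d I = 0 := by
      intro I
      by_cases hI : I ∈ insert {1, 2} (Finset.univ.image b)
      · rcases Finset.mem_insert.1 hI with rfl | hI
        · exact hpair
        · obtain ⟨t, -, rfl⟩ := Finset.mem_image.1 hI
          rw [hsucc, hpair, ite_self, neg_zero]
      · simp [d, h I hI]
    funext I
    exact_mod_cast sub_eq_zero.1 (hd I)

theorem card_evenSets_filter_mem_eq {n : ℕ} (i j : Fin n) :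
    ((evenSets n).filter (i ∈ ·)).card = ((evenSets n).filter (j ∈ ·)).card := by
  refine Finset.card_equiv (Equiv.finsetCongr (Equiv.swap i j)) fun I => ?_
  simp [mem_evenSets, Equiv.finsetCongr_apply, Finset.mem_map_equiv]

/-- The tuples supported on the even nonempty sets with values in `{0, …, M}`. -/
def evenBox (n M : ℕ) : Finset (Finset (Fin n) → ℕ) :=
  Fintype.piFinset fun I => if I ∈ evenSets n then Finset.range (M + 1) else {0}

theorem mem_evenBox {n M : ℕ} {x : Finset (Fin n) → ℕ} :
    x ∈ evenBox n M ↔ ∀ I, x I ≤ M ∧ (I ∉ evenSets n → x I = 0) := by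
  rw [evenBox, Fintype.mem_piFinset]
  refine forall_congr' fun I => ?_
  by_cases hI : I ∈ evenSets n
  · simp [hI]
  · simp only [hI, if_false, Finset.mem_singleton, not_false_eq_true, forall_true_left]
    omega

theorem card_evenBox (n M : ℕ) : (evenBox n M).card = (M + 1) ^ (evenSets n).card := by
  rw [evenBox, Fintype.card_piFinset, ← Finset.prod_const, ← Fintype.prod_ite_mem (evenSets n)]
  exact Fintype.prod_congr _ _ fun I => by split_ifs <;> simp

theorem card_filter_evenBox_le {n m M : ℕ} (hn : n ≠ 0) (hev : Even n)
    (hM : (evenSets n).card * M ≤ m) (s : Fin n → ℕ) :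
    ((evenBox n M).filter fun x =>
      (fun i => ∑ I ∈ Finset.univ.filter (fun I : Finset (Fin n) => i ∈ I), x I) = s).card ≤
      (balancedTuples n m).card := by
  have : NeZero n := ⟨hn⟩
  rcases Finset.eq_empty_or_nonempty ((evenBox n M).filter fun x =>
    (fun i => ∑ I ∈ Finset.univ.filter (fun I : Finset (Fin n) => i ∈ I), x I) = s)
    with hempty | ⟨y, hy⟩
  · simp [hempty]
  rw [Finset.mem_filter, mem_evenBox] at hy
  obtain ⟨hy, hys⟩ := hy
  let D := ((evenSets n).filter ((0 : Fin n) ∈ ·)).card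
  have hDm : D * M ≤ m :=
    (Nat.mul_le_mul_right M (Finset.card_filter_le _ _)).trans hM
  let c : Finset (Fin n) → ℕ := fun I => if I ∈ evenSets n then M else 0
  have hyc : ∀ I, y I ≤ c I := fun I => by
    by_cases hI : I ∈ evenSets n
    · simpa [c, hI] using (hy I).1
    · simp [(hy I).2 hI]
  have hsumc : ∀ i : Fin n,
      ∑ I ∈ Finset.univ.filter (fun I : Finset (Fin n) => i ∈ I), c I = D * M := by
    intro i
    simp only [c, D]
    rw [← Finset.sum_filter, Finset.sum_const, smul_eq_mul, card_evenSets_filter_mem_eq 0 i,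
      Finset.filter_filter]
    congr 2
    ext I
    simp [and_comm]
  have hbal : ∀ x ∈ evenBox n M,
      (fun i => ∑ I ∈ Finset.univ.filter (fun I : Finset (Fin n) => i ∈ I), x I) = s →
      IsBalanced (D * M) (fun I => c I + x I - y I) := by
    intro x hx hxs
    rw [mem_evenBox] at hx
    have hzero : ∀ I ∉ evenSets n, c I + x I - y I = 0 := fun I hI => by
      simp [c, hI, (hx I).2 hI]
    refine ⟨hzero ∅ (by simp [mem_evenSets]), fun I hI => ?_, fun i => ?_⟩
    · exact (hzero I fun h => Nat.not_even_iff_odd.2 hI (mem_evenSets.1 h).2).trans_le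
        zero_le_one
    · have hxy := (congrFun hxs i).trans (congrFun hys i).symm
      have hadd : ∑ I ∈ Finset.univ.filter (fun I : Finset (Fin n) => i ∈ I), (c I + x I - y I) +
          ∑ I ∈ Finset.univ.filter (fun I : Finset (Fin n) => i ∈ I), y I =
          ∑ I ∈ Finset.univ.filter (fun I : Finset (Fin n) => i ∈ I), c I +
          ∑ I ∈ Finset.univ.filter (fun I : Finset (Fin n) => i ∈ I), x I := by
        rw [← Finset.sum_add_distrib, ← Finset.sum_add_distrib]
        exact Finset.sum_congr rfl fun I _ =>
          Nat.sub_add_cancel ((hyc I).trans (Nat.le_add_right _ _))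
      rw [hsumc] at hadd
      beta_reduce
      omega
  refine le_trans ?_ (card_balancedTuples_mono hn hev hDm)
  refine Finset.card_le_card_of_injOn (fun x I => c I + x I - y I) ?_ ?_
  · intro x hx
    have hx := Finset.mem_filter.1 hx
    exact mem_balancedTuples.2 (hbal x hx.1 hx.2)
  · intro x _ x' _ h
    funext I
    have := congrFun h I
    have := hyc I
    simp only at *
    omega

theorem pow_card_evenSets_le {n m M : ℕ} (hn : n ≠ 0) (hev : Even n)
    (hM : (evenSets n).card * M ≤ m) (hpos : 0 < (evenSets n).card) :
    (M + 1) ^ (evenSets n).card ≤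
      (balancedTuples n m).card * ((evenSets n).card * (M + 1)) ^ n := by
  have hmaps : ∀ x ∈ evenBox n M,
      (fun i => ∑ I ∈ Finset.univ.filter (fun I : Finset (Fin n) => i ∈ I), x I) ∈
        Fintype.piFinset fun _ : Fin n => Finset.range ((evenSets n).card * (M + 1)) := by
    intro x hx
    rw [mem_evenBox] at hx
    simp only [Fintype.mem_piFinset, Finset.mem_range]
    intro i
    calc ∑ I ∈ Finset.univ.filter (fun I : Finset (Fin n) => i ∈ I), x I
        ≤ ∑ I, x I := Finset.sum_le_sum_of_subset (Finset.subset_univ _)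
      _ = ∑ I ∈ evenSets n, x I :=
          (Finset.sum_subset (Finset.subset_univ _) fun I _ hI => (hx I).2 hI).symm
      _ ≤ (evenSets n).card * M := Finset.sum_le_card_nsmul _ _ _ fun I _ => (hx I).1
      _ < (evenSets n).card * (M + 1) := Nat.mul_lt_mul_of_pos_left M.lt_succ_self hpos
  have := Finset.card_le_mul_card_image_of_maps_to hmaps _
    fun s _ => card_filter_evenBox_le hn hev hM s
  rwa [card_evenBox, Fintype.card_piFinset_const, Finset.card_range] at this

theorem pow_le_mul_card_balancedTuples {n : ℕ} (hn : n ≠ 0) (hev : Even n)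
    (hle : n ≤ (evenSets n).card) (m : ℕ) :
    m ^ ((evenSets n).card - n) ≤
      (evenSets n).card ^ (evenSets n).card * (balancedTuples n m).card := by
  set N := (evenSets n).card with hN
  have hpos : 0 < N := (Nat.pos_of_ne_zero hn).trans_le hle
  have hcount := pow_card_evenSets_le hn hev (m := m) (M := m / N) (Nat.mul_div_le m N) hpos
  rw [← hN] at hcount
  have hsplit : (m / N + 1) ^ (N - n) ≤ (balancedTuples n m).card * N ^ n := by
    refine Nat.le_of_mul_le_mul_right ?_ (pow_pos (Nat.succ_pos (m / N)) n)
    rwa [← Nat.succ_eq_add_one, ← pow_add, Nat.sub_add_cancel hle, mul_assoc, ← mul_pow]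
  calc m ^ (N - n) ≤ (N * (m / N + 1)) ^ (N - n) :=
        Nat.pow_le_pow_left (Nat.lt_mul_div_succ m hpos).le _
    _ = N ^ (N - n) * (m / N + 1) ^ (N - n) := mul_pow _ _ _
    _ ≤ N ^ (N - n) * ((balancedTuples n m).card * N ^ n) := Nat.mul_le_mul_left _ hsplit
    _ = N ^ (N - n) * N ^ n * (balancedTuples n m).card := by ring
    _ = N ^ N * (balancedTuples n m).card := by rw [← pow_add, Nat.sub_add_cancel hle]

theorem exists_balancedTuples_bounds {k : ℕ} (hk : 1 ≤ k) :
    ∃ c₁ c₂ : ℝ, 0 < c₁ ∧ 0 < c₂ ∧ ∀ m : ℕ, 1 ≤ m →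
      c₁ * (m : ℝ) ^ ((2 : ℤ) ^ (2 * k - 1) - 2 * k - 1) ≤ ((balancedTuples (2 * k) m).card : ℝ) ∧
      ((balancedTuples (2 * k) m).card : ℝ) ≤
        c₂ * ((m : ℝ) ^ ((2 : ℤ) ^ (2 * k - 1) - 2 * k - 1) + 1) := by
  have hn : 2 * k ≠ 0 := by omega
  have hev : Even (2 * k) := even_two_mul k
  have hN := card_evenSets hn
  rcases hk.eq_or_lt with rfl | hk
  · refine ⟨1, 16, one_pos, by norm_num, fun m hm => ⟨?_, ?_⟩⟩
    · have h1 : (1 : ℝ) ≤ (balancedTuples (2 * 1) m).card := by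
        exact_mod_cast one_le_card_balancedTuples hn hev m
      have h2 : (m : ℝ)⁻¹ ≤ 1 := inv_le_one_of_one_le₀ (by exact_mod_cast hm)
      have h3 : (2 : ℤ) ^ (2 * 1 - 1) - 2 * (1 : ℕ) - 1 = -1 := by norm_num
      rw [h3, zpow_neg_one]
      linarith
    · have hsub : {Finset.univ} ⊆ evenSets (2 * 1) := by
        simp [mem_evenSets, Finset.univ_nonempty.ne_empty]
      have h := card_balancedTuples_le hsub (isDetermining_singleton_univ hn) m
      have hcard : (evenSets (2 * 1)).card = 1 := by simpa using hN
      rw [hcard, Finset.card_singleton] at h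
      have h1 : ((balancedTuples (2 * 1) m).card : ℝ) ≤ 16 := by exact_mod_cast h
      have h2 : (0 : ℝ) ≤ (m : ℝ) ^ ((2 : ℤ) ^ (2 * 1 - 1) - 2 * (1 : ℕ) - 1) := by positivity
      linarith
  · obtain ⟨B, hB, hBcard, hdet⟩ := exists_isDetermining (n := 2 * k) (by omega)
    have hle : 2 * k ≤ (evenSets (2 * k)).card := hBcard.symm.trans_le (Finset.card_le_card hB)
    set N := (evenSets (2 * k)).card with hNdef
    have hexp : (2 : ℤ) ^ (2 * k - 1) - 2 * k - 1 = ((N - 2 * k : ℕ) : ℤ) := by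
      have : ((N : ℤ) + 1) = 2 ^ (2 * k - 1) := by exact_mod_cast hN
      rw [← this]
      push_cast [hle]
      ring
    have hNpos : (0 : ℝ) < (N : ℝ) ^ N := by
      have : 0 < N := by omega
      positivity
    refine ⟨((N : ℝ) ^ N)⁻¹, 2 ^ 2 ^ (2 * k) * 2 ^ (N - 2 * k), inv_pos.2 hNpos, by positivity,
      fun m hm => ?_⟩
    rw [hexp, zpow_natCast]
    constructor
    · rw [inv_mul_le_iff₀ hNpos]
      exact_mod_cast pow_le_mul_card_balancedTuples hn hev hle m
    · have h := card_balancedTuples_le hB hdet m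
      rw [hBcard, ← hNdef] at h
      have h' : ((balancedTuples (2 * k) m).card : ℝ) ≤
          2 ^ 2 ^ (2 * k) * ((m : ℝ) + 1) ^ (N - 2 * k) := by exact_mod_cast h
      have hm' : (1 : ℝ) ≤ m := by exact_mod_cast hm
      calc ((balancedTuples (2 * k) m).card : ℝ)
          ≤ 2 ^ 2 ^ (2 * k) * ((m : ℝ) + 1) ^ (N - 2 * k) := h'
        _ ≤ 2 ^ 2 ^ (2 * k) * (2 * (m : ℝ)) ^ (N - 2 * k) := by
            gcongr
            linarith
        _ = 2 ^ 2 ^ (2 * k) * 2 ^ (N - 2 * k) * (m : ℝ) ^ (N - 2 * k) := by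
            rw [mul_pow, mul_assoc]
        _ ≤ 2 ^ 2 ^ (2 * k) * 2 ^ (N - 2 * k) * ((m : ℝ) ^ (N - 2 * k) + 1) := by
            gcongr
            linarith

/-- For each fixed `k ≥ 1`, the function `m ↦ c(m,k)` is non-decreasing in `m`, and
`c(m,k) ≍_k m^{2^{2k−1}−2k−1} + 1` for `m ≥ 1`. -/
theorem permTupleCount_monotone_and_asymp (k : ℕ) (hk : 1 ≤ k) :
    (∀ m₁ m₂ : ℕ, 1 ≤ m₁ → m₁ ≤ m₂ → permTupleCount m₁ k ≤ permTupleCount m₂ k) ∧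
    ∃ c₁ c₂ : ℝ, 0 < c₁ ∧ 0 < c₂ ∧ ∀ m : ℕ, 1 ≤ m →
      c₁ * ((m : ℝ) ^ ((2 : ℤ) ^ (2 * k - 1) - 2 * k - 1) + 1) ≤ (permTupleCount m k : ℝ) ∧
      (permTupleCount m k : ℝ) ≤
        c₂ * ((m : ℝ) ^ ((2 : ℤ) ^ (2 * k - 1) - 2 * k - 1) + 1) := by
  have hn : 2 * k ≠ 0 := by omega
  have hev : Even (2 * k) := even_two_mul k
  simp only [permTupleCount_eq_card]
  refine ⟨fun m₁ m₂ _ h => card_balancedTuples_mono hn hev h, ?_⟩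
  obtain ⟨c₁, c₂, hc₁, hc₂, h⟩ := exists_balancedTuples_bounds hk
  refine ⟨min c₁ 1 / 2, c₂, by positivity, hc₂, fun m hm => ⟨?_, (h m hm).2⟩⟩
  have hone : (1 : ℝ) ≤ (balancedTuples (2 * k) m).card := by
    exact_mod_cast one_le_card_balancedTuples hn hev m
  have hpow : (0 : ℝ) ≤ (m : ℝ) ^ ((2 : ℤ) ^ (2 * k - 1) - 2 * k - 1) := by positivity
  have hmin := mul_le_mul_of_nonneg_right (min_le_left c₁ 1) hpow
  linarith [(h m hm).1, min_le_right c₁ 1]
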